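/- Summed averaging estimates over stretched kinetic cylinders (Lemma B.4). Let d ≥ 1, α ∈ (0,1), c ≥ 1, r > 0, T ∈ (−∞,∞], and z₀ = (t₀,x₀,v₀) with t₀ ≤ T. Then there exists N = N(α) > 0 such that: (i) if f : ℝ^{1+2d}_T → ℝ is, for each t, continuous in (x,v), measurable, and A := sup_{t<T} [f(t,·)]_{C^{α/3,α}_{x,v}(ℝ^{2d})} < ∞, then, with χ(t) := f(t, x₀ − (t−t₀)v₀, v₀), Σ_{k=0}^∞ 2^{−k} ( |f − χ|² )^{1/2}_{Q_{r,2^k c r}(z₀)} ≤ N A (cr)^α; (ii) if h : ℝ^{1+2d}_T → ℝ satisfies [h]_{kC^α(ℝ^{1+2d}_T)} < ∞, then Σ_{k=0}^∞ 2^{−k} ( |h − (h)_{Q_{r,2^k c r}(z₀)}|² )^{1/2}_{Q_{r,2^k c r}(z₀)} ≤ N [h]_{kC^α(ℝ^{1+2d}_T)} (cr)^α. -/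

import Mathlib

open MeasureTheory ENNReal Set

noncomputable section

/-- Euclidean space `ℝ^d`. -/
abbrev Ed (d : ℕ) : Type := EuclideanSpace ℝ (Fin d)

/-- Points `z = (t, x, v) ∈ ℝ × ℝ^d × ℝ^d`. -/
abbrev Pt (d : ℕ) : Type := ℝ × Ed d × Ed d

/-- The kinetic quasi-distance `ρ(z, z₀)`. -/
def kRho {d : ℕ} (z z0 : Pt d) : ℝ :=
  max (|z.1 - z0.1| ^ ((1 : ℝ)/2))
    (max (‖z.2.1 - z0.2.1 + (z.1 - z0.1) • z0.2.2‖ ^ ((1 : ℝ)/3)) ‖z.2.2 - z0.2.2‖)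

/-- The kinetic Hölder seminorm `[u]_{kC^α(G)}` (extended-real valued). -/
def kSemi {d : ℕ} {F : Type*} [NormedAddCommGroup F] (α : ℝ) (G : Set (Pt d))
    (u : Pt d → F) : ℝ≥0∞ :=
  ⨆ (z : Pt d) (_ : z ∈ G) (z' : Pt d) (_ : z' ∈ G) (_ : z ≠ z'),
    ENNReal.ofReal (‖u z - u z'‖ / kRho z z' ^ α)

/-- The sup (`L_∞`) norm over `G`, extended-real valued. -/
def supNorm {d : ℕ} {F : Type*} [NormedAddCommGroup F] (G : Set (Pt d))
    (u : Pt d → F) : ℝ≥0∞ :=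
  ⨆ (z : Pt d) (_ : z ∈ G), (‖u z‖₊ : ℝ≥0∞)

/-- Anisotropic Hölder seminorm `[w]_{C^{α/3,α}_{x,v}(D)}`. -/
def anisoSemi {d : ℕ} {F : Type*} [NormedAddCommGroup F] (α : ℝ) (D : Set (Ed d × Ed d))
    (w : Ed d × Ed d → F) : ℝ≥0∞ :=
  ⨆ (p : Ed d × Ed d) (_ : p ∈ D) (q : Ed d × Ed d) (_ : q ∈ D) (_ : p ≠ q),
    ENNReal.ofReal (‖w p - w q‖ / (‖p.1 - q.1‖ ^ ((1 : ℝ)/3) + ‖p.2 - q.2‖) ^ α)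

/-- The `L_∞ C^{α/3,α}_{x,v}` seminorm over `I × D`. -/
def lixvSemi {d : ℕ} {F : Type*} [NormedAddCommGroup F] (α : ℝ) (I : Set ℝ)
    (D : Set (Ed d × Ed d)) (u : Pt d → F) : ℝ≥0∞ :=
  ⨆ (t : ℝ) (_ : t ∈ I), anisoSemi α D (fun p => u (t, p.1, p.2))

/-- The time interval `(−∞, T)` for `T ∈ (−∞, ∞]`. -/
def slabI (T : EReal) : Set ℝ := {t : ℝ | (t : EReal) < T}

/-- The set `ℝ^{1+2d}_T = (−∞,T) × ℝ^{2d}`. -/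
def slabG (d : ℕ) (T : EReal) : Set (Pt d) := slabI T ×ˢ (Set.univ : Set (Ed d × Ed d))

/-- Classical time derivative `∂_t u`. -/
def Dt {d : ℕ} (u : Pt d → ℝ) (z : Pt d) : ℝ := deriv (fun s => u (s, z.2.1, z.2.2)) z.1

/-- Classical spatial gradient `D_x u`. -/
def Dx {d : ℕ} (u : Pt d → ℝ) (z : Pt d) : Ed d →L[ℝ] ℝ :=
  fderiv ℝ (fun y => u (z.1, y, z.2.2)) z.2.1

/-- Classical velocity gradient `D_v u`. -/
def Dv {d : ℕ} (u : Pt d → ℝ) (z : Pt d) : Ed d →L[ℝ] ℝ :=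
  fderiv ℝ (fun w => u (z.1, z.2.1, w)) z.2.2

/-- Classical velocity Hessian `D²_v u`. -/
def Dvv {d : ℕ} (u : Pt d → ℝ) (z : Pt d) : Ed d →L[ℝ] Ed d →L[ℝ] ℝ :=
  fderiv ℝ (fun w => Dv u (z.1, z.2.1, w)) z.2.2

/-- Transport term `Y u = ∂_t u − v · D_x u`. -/
def Yop {d : ℕ} (u : Pt d → ℝ) (z : Pt d) : ℝ := Dt u z - Dx u z z.2.2

/-- Contraction `a^{ij} B_{ij}`. -/
def contr2 {d : ℕ} (A : Matrix (Fin d) (Fin d) ℝ) (B : Ed d →L[ℝ] Ed d →L[ℝ] ℝ) : ℝ :=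
  ∑ i, ∑ j, A i j * B (EuclideanSpace.single i 1) (EuclideanSpace.single j 1)

/-- KFP operator `P u = ∂_t u − v·D_x u − a^{ij}(z) D_{v_iv_j} u`. -/
def Pop {d : ℕ} (a : Pt d → Matrix (Fin d) (Fin d) ℝ) (u : Pt d → ℝ) (z : Pt d) : ℝ :=
  Yop u z - contr2 (a z) (Dvv u z)

/-- Model KFP operator with `a = a(t)`. -/
def P0op {d : ℕ} (a : ℝ → Matrix (Fin d) (Fin d) ℝ) (u : Pt d → ℝ) (z : Pt d) : ℝ :=
  Yop u z - contr2 (a z.1) (Dvv u z)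

/-- Laplacian in the velocity variable `Δ_v u`. -/
def lapV {d : ℕ} (u : Pt d → ℝ) (z : Pt d) : ℝ :=
  ∑ i, Dvv u z (EuclideanSpace.single i 1) (EuclideanSpace.single i 1)

/-- Fractional Laplacian `(−Δ_x)^{1/3} u`, pointwise integral formula with constant `cd`. -/
def fracLap {d : ℕ} (cd : ℝ) (u : Pt d → ℝ) (z : Pt d) : ℝ :=
  cd * ∫ y : Ed d, (u z - u (z.1, z.2.1 + y, z.2.2)) / ‖y‖ ^ ((d : ℝ) + 2/3)

/-- Hölder seminorm in `x` of a function on `ℝ^d`. -/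
def xSemi {d : ℕ} (β : ℝ) (w : Ed d → ℝ) : ℝ≥0∞ :=
  ⨆ (x : Ed d) (x' : Ed d) (_ : x ≠ x'), ENNReal.ofReal (|w x - w x'| / ‖x - x'‖ ^ β)

/-- `sup_{t ∈ I, v} [u(t,·,v)]_{C^β(ℝ^d)}`. -/
def supXSemi {d : ℕ} (β : ℝ) (I : Set ℝ) (u : Pt d → ℝ) : ℝ≥0∞ :=
  ⨆ (t : ℝ) (_ : t ∈ I) (v : Ed d), xSemi β (fun x => u (t, x, v))

/-- Hölder norm in `x` over a set `A ⊂ ℝ^d`. -/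
def xHolderNorm {d : ℕ} (β : ℝ) (A : Set (Ed d)) (w : Ed d → ℝ) : ℝ≥0∞ :=
  (⨆ (x : Ed d) (_ : x ∈ A), ENNReal.ofReal |w x|) +
    ⨆ (x : Ed d) (_ : x ∈ A) (x' : Ed d) (_ : x' ∈ A) (_ : x ≠ x'),
      ENNReal.ofReal (|w x - w x'| / ‖x - x'‖ ^ β)

/-- Kinetic cylinder `Q_{r,s}(z₀)` (`v`-radius `r`, `x`-radius `s³`). -/
def kCyl {d : ℕ} (r s : ℝ) (z0 : Pt d) : Set (Pt d) :=
  {z : Pt d | z0.1 - r ^ 2 < z.1 ∧ z.1 < z0.1 ∧ ‖z.2.2 - z0.2.2‖ < r ∧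
    ‖z.2.1 - z0.2.1 + (z.1 - z0.1) • z0.2.2‖ < s ^ 3}

/-- Kinetic cylinder `Q_r(z₀)`. -/
def kQ {d : ℕ} (r : ℝ) (z0 : Pt d) : Set (Pt d) := kCyl r r z0

/-- The origin of `ℝ^{1+2d}`. -/
def ptO (d : ℕ) : Pt d := (0, 0, 0)

/-- Mean-square average `(|g|²)^{1/2}_A`. -/
def msq {d : ℕ} {F : Type*} [NormedAddCommGroup F] (A : Set (Pt d)) (g : Pt d → F) : ℝ :=
  Real.sqrt (⨍ z in A, ‖g z‖ ^ 2)

/-- Average `(g)_A`. -/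
def avg {d : ℕ} {F : Type*} [NormedAddCommGroup F] [NormedSpace ℝ F] (A : Set (Pt d))
    (g : Pt d → F) : F :=
  ⨍ z in A, g z

/-- Mean-square oscillation `(|g − (g)_A|²)^{1/2}_A`. -/
def oscL2 {d : ℕ} {F : Type*} [NormedAddCommGroup F] [NormedSpace ℝ F] (A : Set (Pt d))
    (g : Pt d → F) : ℝ :=
  msq A (fun z => g z - avg A g)

/-- `L²` norm over `A`. -/
def l2 {d : ℕ} {F : Type*} [NormedAddCommGroup F] (A : Set (Pt d)) (g : Pt d → F) : ℝ :=
  Real.sqrt (∫ z in A, ‖g z‖ ^ 2)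

/-- Membership in the kinetic Hölder space `kC^{2,α}(I × D)`:
`u ∈ kC^α`, the classical derivatives `D_v u`, `D²_v u`, `Y u` exist,
`Y u ∈ L_∞ C^{α/3,α}_{x,v}` and `[D²_v u]_{kC^α} < ∞`. -/
def kC2mem {d : ℕ} (α : ℝ) (I : Set ℝ) (D : Set (Ed d × Ed d)) (u : Pt d → ℝ) : Prop :=
  supNorm (I ×ˢ D) u < ⊤ ∧ kSemi α (I ×ˢ D) u < ⊤ ∧
  (∀ z ∈ I ×ˢ D, DifferentiableAt ℝ (fun s => u (s, z.2.1, z.2.2)) z.1) ∧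
  (∀ z ∈ I ×ˢ D, DifferentiableAt ℝ (fun y => u (z.1, y, z.2.2)) z.2.1) ∧
  (∀ z ∈ I ×ˢ D, DifferentiableAt ℝ (fun w => u (z.1, z.2.1, w)) z.2.2) ∧
  (∀ z ∈ I ×ˢ D, DifferentiableAt ℝ (fun w => Dv u (z.1, z.2.1, w)) z.2.2) ∧
  supNorm (I ×ˢ D) (Yop u) < ⊤ ∧
  lixvSemi α I D (Yop u) < ⊤ ∧
  kSemi α (I ×ˢ D) (Dvv u) < ⊤

/-- Membership in the anisotropic Hölder space `ℂ^{2,α}(I × D)`: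
the classical derivatives `D_v u`, `D²_v u`, `Y u` exist and
`u, D_v u, D²_v u, Y u ∈ L_∞ C^{α/3,α}_{x,v}(I × D)`. -/
def C2mem {d : ℕ} (α : ℝ) (I : Set ℝ) (D : Set (Ed d × Ed d)) (u : Pt d → ℝ) : Prop :=
  (∀ z ∈ I ×ˢ D, DifferentiableAt ℝ (fun s => u (s, z.2.1, z.2.2)) z.1) ∧
  (∀ z ∈ I ×ˢ D, DifferentiableAt ℝ (fun y => u (z.1, y, z.2.2)) z.2.1) ∧
  (∀ z ∈ I ×ˢ D, DifferentiableAt ℝ (fun w => u (z.1, z.2.1, w)) z.2.2) ∧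
  (∀ z ∈ I ×ˢ D, DifferentiableAt ℝ (fun w => Dv u (z.1, z.2.1, w)) z.2.2) ∧
  supNorm (I ×ˢ D) u < ⊤ ∧ lixvSemi α I D u < ⊤ ∧
  supNorm (I ×ˢ D) (Dv u) < ⊤ ∧ lixvSemi α I D (Dv u) < ⊤ ∧
  supNorm (I ×ˢ D) (Dvv u) < ⊤ ∧ lixvSemi α I D (Dvv u) < ⊤ ∧
  supNorm (I ×ˢ D) (Yop u) < ⊤ ∧ lixvSemi α I D (Yop u) < ⊤

/-- Ellipticity and boundedness of a coefficient matrix: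
`a^{ij} ξ_i ξ_j ≥ δ|ξ|²` and `|a| ≤ δ⁻¹`. -/
def elliptic {d : ℕ} (δ : ℝ) (A : Matrix (Fin d) (Fin d) ℝ) : Prop :=
  (∀ ξ : Ed d, δ * ‖ξ‖ ^ 2 ≤ ∑ i, ∑ j, A i j * ξ i * ξ j) ∧ (∀ i j, |A i j| ≤ δ⁻¹)

/-- Iterated classical mixed derivative `D_v^m D_x^l u`. -/
def Dmix {d : ℕ} (l m : ℕ) (u : Pt d → ℝ) (z : Pt d) :
    ContinuousMultilinearMap ℝ (fun _ : Fin m => Ed d)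
      (ContinuousMultilinearMap ℝ (fun _ : Fin l => Ed d) ℝ) :=
  iteratedFDeriv ℝ m (fun w => iteratedFDeriv ℝ l (fun y => u (z.1, y, w)) z.2.1) z.2.2

/-- Time derivative of the mixed derivative: `∂_t D_x^l D_v^m u`. -/
def DtMix {d : ℕ} (l m : ℕ) (u : Pt d → ℝ) (z : Pt d) :
    ContinuousMultilinearMap ℝ (fun _ : Fin m => Ed d)
      (ContinuousMultilinearMap ℝ (fun _ : Fin l => Ed d) ℝ) :=
  deriv (fun s => Dmix l m u (s, z.2.1, z.2.2)) z.1

/-- `∂_t` for functions of `(t,v)`. -/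
def Dt2 {d : ℕ} (w : ℝ × Ed d → ℝ) (t : ℝ) (v : Ed d) : ℝ := deriv (fun s => w (s, v)) t

/-- `D_v` for functions of `(t,v)`. -/
def Dv2 {d : ℕ} (w : ℝ × Ed d → ℝ) (t : ℝ) (v : Ed d) : Ed d →L[ℝ] ℝ :=
  fderiv ℝ (fun y => w (t, y)) v

/-- `D²_v` for functions of `(t,v)`. -/
def Dvv2 {d : ℕ} (w : ℝ × Ed d → ℝ) (t : ℝ) (v : Ed d) : Ed d →L[ℝ] Ed d →L[ℝ] ℝ :=
  fderiv ℝ (fun y => Dv2 w t y) v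

/-- The kinetic scaling `z ↦ z̃ = (r²t + t₀, r³x + x₀ − r²t v₀, rv + v₀)`. -/
def kScale {d : ℕ} (r : ℝ) (z0 z : Pt d) : Pt d :=
  (r ^ 2 * z.1 + z0.1, (r ^ 3) • z.2.1 + z0.2.1 - (r ^ 2 * z.1) • z0.2.2, r • z.2.2 + z0.2.2)

/-- Kinetic Campanato seminorm. -/
def campSemi {d : ℕ} (α : ℝ) (T : EReal) (u : Pt d → ℝ) : ℝ≥0∞ :=
  ⨆ (r : ℝ) (_ : 0 < r) (z0 : Pt d) (_ : (z0.1 : EReal) ≤ T),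
    ENNReal.ofReal (oscL2 (kQ r z0) u / r ^ α)

end

section CylinderEstimates

open MeasureTheory ENNReal Set

variable {d : ℕ}

theorem le_toReal_mul_rpow_of_ofReal_div_le {a ρ α : ℝ} {K : ℝ≥0∞} (hK : K < ⊤)
    (hρ : 0 < ρ) (h : ENNReal.ofReal (a / ρ ^ α) ≤ K) : a ≤ K.toReal * ρ ^ α := by
  have h1 := (ENNReal.ofReal_le_iff_le_toReal hK.ne).1 h
  rwa [div_le_iff₀ (Real.rpow_pos_of_pos hρ α)] at h1

theorem kRho_nonneg (z z' : Pt d) : 0 ≤ kRho z z' :=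
  (Real.rpow_nonneg (abs_nonneg _) _).trans (le_max_left _ _)

theorem kRho_pos {z z' : Pt d} (h : z ≠ z') : 0 < kRho z z' := by
  rcases eq_or_ne z.1 z'.1 with ht | ht
  · rcases eq_or_ne z.2.2 z'.2.2 with hv | hv
    · have hx : z.2.1 ≠ z'.2.1 := fun hx => h (Prod.ext ht (Prod.ext hx hv))
      have : 0 < ‖z.2.1 - z'.2.1 + (z.1 - z'.1) • z'.2.2‖ := by
        simpa [ht, sub_eq_zero] using hx
      exact (Real.rpow_pos_of_pos this _).trans_le ((le_max_left _ _).trans (le_max_right _ _))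
    · exact (norm_pos_iff.2 (sub_ne_zero.2 hv)).trans_le
        ((le_max_right _ _).trans (le_max_right _ _))
  · exact (Real.rpow_pos_of_pos (abs_pos.2 (sub_ne_zero.2 ht)) _).trans_le (le_max_left _ _)

theorem kRho_self (z : Pt d) : kRho z z = 0 := by
  simp [kRho]

theorem continuous_kRho_left (z' : Pt d) : Continuous fun z : Pt d => kRho z z' := by
  unfold kRho
  refine Continuous.max ?_ (Continuous.max ?_ (by fun_prop))
  · exact Continuous.rpow_const (by fun_prop) fun _ => Or.inr (by norm_num)
  · exact Continuous.rpow_const (by fun_prop) fun _ => Or.inr (by norm_num)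

theorem norm_sub_le_kSemi {F : Type*} [NormedAddCommGroup F] {α : ℝ} {G : Set (Pt d)}
    {u : Pt d → F} (hu : kSemi α G u < ⊤) {z z' : Pt d} (hz : z ∈ G) (hz' : z' ∈ G) :
    ‖u z - u z'‖ ≤ (kSemi α G u).toReal * kRho z z' ^ α := by
  rcases eq_or_ne z z' with rfl | hne
  · simpa using mul_nonneg ENNReal.toReal_nonneg (Real.rpow_nonneg (kRho_nonneg z z) α)
  · refine le_toReal_mul_rpow_of_ofReal_div_le hu (kRho_pos hne) ?_
    exact le_iSup_of_le z <| le_iSup_of_le hz <| le_iSup_of_le z' <| le_iSup_of_le hz' <|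
      le_iSup_of_le hne le_rfl

theorem continuousOn_of_kSemi_lt_top {F : Type*} [NormedAddCommGroup F] {α : ℝ} (hα : 0 < α)
    {G : Set (Pt d)} {u : Pt d → F} (hu : kSemi α G u < ⊤) : ContinuousOn u G := by
  intro z' hz'
  rw [ContinuousWithinAt, tendsto_iff_norm_sub_tendsto_zero]
  have hcont : Continuous fun z => (kSemi α G u).toReal * kRho z z' ^ α :=
    continuous_const.mul ((continuous_kRho_left z').rpow_const fun _ => Or.inr hα.le)
  have hlim := (hcont.tendsto z').mono_left (nhdsWithin_le_nhds (s := G))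
  rw [kRho_self, Real.zero_rpow hα.ne', mul_zero] at hlim
  refine squeeze_zero' (Filter.Eventually.of_forall fun _ => norm_nonneg _) ?_ hlim
  filter_upwards [self_mem_nhdsWithin] with z hz using norm_sub_le_kSemi hu hz hz'

theorem norm_sub_le_lixvSemi {F : Type*} [NormedAddCommGroup F] {α : ℝ} {I : Set ℝ}
    {D : Set (Ed d × Ed d)} {u : Pt d → F} (hu : lixvSemi α I D u < ⊤) {t : ℝ} (ht : t ∈ I)
    {p q : Ed d × Ed d} (hp : p ∈ D) (hq : q ∈ D) :
    ‖u (t, p.1, p.2) - u (t, q.1, q.2)‖ ≤ (lixvSemi α I D u).toReal *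
      (‖p.1 - q.1‖ ^ ((1 : ℝ) / 3) + ‖p.2 - q.2‖) ^ α := by
  rcases eq_or_ne p q with rfl | hne
  · simp only [sub_self, norm_zero]
    positivity
  · refine le_toReal_mul_rpow_of_ofReal_div_le hu ?_ ?_
    · rcases eq_or_ne p.1 q.1 with hx | hx
      · have hv : p.2 ≠ q.2 := fun hv => hne (Prod.ext hx hv)
        have := norm_pos_iff.2 (sub_ne_zero.2 hv)
        positivity
      · have := norm_pos_iff.2 (sub_ne_zero.2 hx)
        positivity
    · exact le_iSup_of_le t <| le_iSup_of_le ht <| le_iSup_of_le p <| le_iSup_of_le hp <|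
        le_iSup_of_le q <| le_iSup_of_le hq <| le_iSup_of_le hne le_rfl

theorem isOpen_kCyl (r s : ℝ) (z0 : Pt d) : IsOpen (kCyl r s z0) := by
  have h1 : IsOpen {z : Pt d | z0.1 - r ^ 2 < z.1} := isOpen_lt (by fun_prop) (by fun_prop)
  have h2 : IsOpen {z : Pt d | z.1 < z0.1} := isOpen_lt (by fun_prop) (by fun_prop)
  have h3 : IsOpen {z : Pt d | ‖z.2.2 - z0.2.2‖ < r} := isOpen_lt (by fun_prop) (by fun_prop)
  have h4 : IsOpen {z : Pt d | ‖z.2.1 - z0.2.1 + (z.1 - z0.1) • z0.2.2‖ < s ^ 3} :=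
    isOpen_lt (by fun_prop) (by fun_prop)
  exact h1.inter (h2.inter (h3.inter h4))

theorem volume_kCyl_lt_top (r s : ℝ) (z0 : Pt d) : volume (kCyl r s z0) < ⊤ := by
  have hsub : kCyl r s z0 ⊆ Ioo (z0.1 - r ^ 2) z0.1 ×ˢ
      (Metric.ball z0.2.1 (s ^ 3 + r ^ 2 * ‖z0.2.2‖) ×ˢ Metric.ball z0.2.2 r) := by
    rintro z ⟨h1, h2, h3, h4⟩
    refine ⟨⟨h1, h2⟩, ?_, mem_ball_iff_norm.2 h3⟩
    have h5 : ‖(z.1 - z0.1) • z0.2.2‖ ≤ r ^ 2 * ‖z0.2.2‖ := by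
      rw [norm_smul, Real.norm_eq_abs]
      gcongr
      rw [abs_le]
      constructor <;> nlinarith [sq_nonneg r]
    have h6 := norm_sub_le (z.2.1 - z0.2.1 + (z.1 - z0.1) • z0.2.2) ((z.1 - z0.1) • z0.2.2)
    rw [add_sub_cancel_right] at h6
    exact mem_ball_iff_norm.2 (by linarith)
  exact (((Metric.isBounded_Ioo _ _).prod
    (Metric.isBounded_ball.prod Metric.isBounded_ball)).subset hsub).measure_lt_top

theorem kCyl_subset_slabG {r s : ℝ} {z0 : Pt d} {T : EReal} (hT : (z0.1 : EReal) ≤ T) :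
    kCyl r s z0 ⊆ slabG d T := fun _ hz =>
  ⟨(EReal.coe_lt_coe_iff.2 hz.2.1).trans_le hT, mem_univ _⟩

theorem rpow_one_third_le {a b : ℝ} (ha : 0 ≤ a) (hb : 0 ≤ b) (h : a ≤ b ^ 3) :
    a ^ ((1 : ℝ) / 3) ≤ b := by
  calc a ^ ((1 : ℝ) / 3) ≤ (b ^ 3) ^ ((1 : ℝ) / 3) := Real.rpow_le_rpow ha h (by norm_num)
    _ = b := by
      rw [← Real.rpow_natCast, ← Real.rpow_mul hb]
      norm_num

/-- The quasi-diameter of `Q_{r,s}` is at most `2s` when `r ≤ s`. -/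
theorem kRho_le_of_mem_kCyl {r s : ℝ} (hr : 0 < r) (hrs : r ≤ s) {z0 z z' : Pt d}
    (hz : z ∈ kCyl r s z0) (hz' : z' ∈ kCyl r s z0) : kRho z z' ≤ 2 * s := by
  obtain ⟨a1, a2, a3, a4⟩ := hz
  obtain ⟨b1, b2, b3, b4⟩ := hz'
  have ht : |z.1 - z'.1| ≤ r ^ 2 := by
    rw [abs_le]
    constructor <;> linarith
  refine max_le ?_ (max_le ?_ ?_)
  · rw [← Real.sqrt_eq_rpow]
    refine (Real.sqrt_le_sqrt ht).trans ?_
    rw [Real.sqrt_sq hr.le]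
    linarith
  · refine rpow_one_third_le (norm_nonneg _) (by linarith) ?_
    have hsplit : z.2.1 - z'.2.1 + (z.1 - z'.1) • z'.2.2 =
        (z.2.1 - z0.2.1 + (z.1 - z0.1) • z0.2.2) - (z'.2.1 - z0.2.1 + (z'.1 - z0.1) • z0.2.2) +
          (z.1 - z'.1) • (z'.2.2 - z0.2.2) := by
      module
    have hlast : ‖(z.1 - z'.1) • (z'.2.2 - z0.2.2)‖ ≤ r ^ 2 * r := by
      rw [norm_smul, Real.norm_eq_abs]
      gcongr
    have hcube : r ^ 3 ≤ s ^ 3 := by gcongr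
    have hs3 : 0 < s ^ 3 := pow_pos (hr.trans_le hrs) 3
    rw [hsplit]
    have h1 := norm_add_le
      ((z.2.1 - z0.2.1 + (z.1 - z0.1) • z0.2.2) - (z'.2.1 - z0.2.1 + (z'.1 - z0.1) • z0.2.2))
      ((z.1 - z'.1) • (z'.2.2 - z0.2.2))
    have h2 := norm_sub_le (z.2.1 - z0.2.1 + (z.1 - z0.1) • z0.2.2)
      (z'.2.1 - z0.2.1 + (z'.1 - z0.1) • z0.2.2)
    nlinarith
  · have h := norm_sub_le (z.2.2 - z0.2.2) (z'.2.2 - z0.2.2)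
    rw [sub_sub_sub_cancel_right] at h
    linarith

theorem msq_le_of_norm_le {F : Type*} [NormedAddCommGroup F] {A : Set (Pt d)} {g : Pt d → F}
    {M : ℝ} (hM : 0 ≤ M) (hA' : volume A < ⊤) (hg : ∀ z ∈ A, ‖g z‖ ≤ M) : msq A g ≤ M := by
  refine Real.sqrt_le_iff.2 ⟨hM, ?_⟩
  have h1 : ∫ z in A, ‖g z‖ ^ 2 ≤ M ^ 2 * volume.real A := by
    refine (Real.le_norm_self _).trans (norm_setIntegral_le_of_norm_le_const hA' fun z hz => ?_)
    rw [Real.norm_eq_abs, abs_of_nonneg (by positivity)]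
    exact pow_le_pow_left₀ (norm_nonneg _) (hg z hz) 2
  rw [setAverage_eq, smul_eq_mul]
  rcases (measureReal_nonneg (μ := volume) (s := A)).eq_or_lt with h0 | h0
  · rw [← h0]
    simpa using sq_nonneg M
  · rwa [inv_mul_le_iff₀ h0, mul_comm]

theorem oscL2_le_of_norm_sub_le {A : Set (Pt d)} {h : Pt d → ℝ} {M : ℝ} (hM : 0 ≤ M)
    (hA : IsOpen A) (hA' : volume A < ⊤) (hc : ContinuousOn h A)
    (hh : ∀ z ∈ A, ∀ z' ∈ A, ‖h z' - h z‖ ≤ M) : oscL2 A h ≤ M := by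
  refine msq_le_of_norm_le hM hA' fun z hz => ?_
  have hmem : ∀ z' ∈ A, h z' ∈ Metric.closedBall (h z) M := fun z' hz' =>
    mem_closedBall_iff_norm.2 (hh z hz z' hz')
  have hint : IntegrableOn h A := by
    refine IntegrableOn.of_bound hA' (hc.aestronglyMeasurable hA.measurableSet) (‖h z‖ + M) ?_
    refine (ae_restrict_iff' hA.measurableSet).2 (Filter.Eventually.of_forall fun z' hz' => ?_)
    have := norm_le_norm_add_norm_sub' (h z') (h z)
    linarith [hh z hz z' hz']
  have hpos : 0 < volume A := by
    have : (volume : Measure (Ed d × Ed d)).IsOpenPosMeasure :=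
      inferInstanceAs ((volume : Measure (Ed d)).prod volume).IsOpenPosMeasure
    have : (volume : Measure (Pt d)).IsOpenPosMeasure :=
      inferInstanceAs ((volume : Measure ℝ).prod
        (volume : Measure (Ed d × Ed d))).IsOpenPosMeasure
    exact hA.measure_pos volume ⟨z, hz⟩
  have havg : avg A h ∈ Metric.closedBall (h z) M :=
    (convex_closedBall _ _).set_average_mem Metric.isClosed_closedBall
      hpos.ne' hA'.ne
      ((ae_restrict_iff' hA.measurableSet).2 (Filter.Eventually.of_forall hmem)) hint
  rw [norm_sub_rev]
  exact mem_closedBall_iff_norm.1 havg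

/-- Summation of a geometric series of averages growing like `(2^k R)^α` with `α < 1`. -/
theorem tsum_ofReal_le_of_le_rpow {α R : ℝ} (hα : α ∈ Ioo (0 : ℝ) 1) (hR : 0 ≤ R) {K : ℝ≥0∞}
    (hK : K < ⊤) {a : ℕ → ℝ} (ha : ∀ k, a k ≤ K.toReal * (2 * (2 ^ k * R)) ^ α) :
    ∑' k : ℕ, ENNReal.ofReal ((2 : ℝ) ^ (-(k : ℝ)) * a k) ≤
      ENNReal.ofReal (2 ^ α * (1 - 2 ^ (α - 1))⁻¹ * R ^ α) * K := by
  have hq0 : (0 : ℝ) ≤ 2 ^ (α - 1) := by positivity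
  have hq1 : (2 : ℝ) ^ (α - 1) < 1 :=
    Real.rpow_lt_one_of_one_lt_of_neg one_lt_two (by linarith [hα.2])
  have hterm : ∀ k : ℕ, (2 : ℝ) ^ (-(k : ℝ)) * a k ≤
      (2 ^ α * R ^ α * K.toReal) * (2 ^ (α - 1)) ^ k := by
    intro k
    calc (2 : ℝ) ^ (-(k : ℝ)) * a k
        ≤ (2 : ℝ) ^ (-(k : ℝ)) * (K.toReal * (2 * (2 ^ k * R)) ^ α) := by
          gcongr
          exact ha k
      _ = (2 ^ α * R ^ α * K.toReal) * (2 ^ (α - 1)) ^ k := by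
          rw [Real.mul_rpow (by norm_num) (by positivity), Real.mul_rpow (by positivity) hR,
            ← Real.rpow_natCast, ← Real.rpow_natCast, ← Real.rpow_mul (by norm_num),
            ← Real.rpow_mul (by norm_num)]
          have : (2 : ℝ) ^ ((α - 1) * k) = 2 ^ (-(k : ℝ)) * 2 ^ ((k : ℝ) * α) := by
            rw [← Real.rpow_add (by norm_num)]
            ring_nf
          rw [this]
          ring
  have hsum := (hasSum_geometric_of_lt_one hq0 hq1).mul_left (2 ^ α * R ^ α * K.toReal)
  calc ∑' k : ℕ, ENNReal.ofReal ((2 : ℝ) ^ (-(k : ℝ)) * a k)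
      ≤ ∑' k : ℕ, ENNReal.ofReal ((2 ^ α * R ^ α * K.toReal) * (2 ^ (α - 1)) ^ k) :=
        ENNReal.tsum_le_tsum fun k => ENNReal.ofReal_le_ofReal (hterm k)
    _ = ENNReal.ofReal (2 ^ α * (1 - 2 ^ (α - 1))⁻¹ * R ^ α * K.toReal) := by
        rw [← ENNReal.ofReal_tsum_of_nonneg (fun k => by positivity) hsum.summable, hsum.tsum_eq]
        ring_nf
    _ = ENNReal.ofReal (2 ^ α * (1 - 2 ^ (α - 1))⁻¹ * R ^ α) * K := by
        rw [ENNReal.ofReal_mul' ENNReal.toReal_nonneg, ENNReal.ofReal_toReal hK.ne]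

end CylinderEstimates

open MeasureTheory ENNReal Set in
/-- **Lemma B.4**: summed averaging estimates over stretched kinetic cylinders. -/
theorem summed_cylinder_estimates (d : ℕ) (hd : 1 ≤ d) (α : ℝ)
    (hα : α ∈ Set.Ioo (0:ℝ) 1) :
    ∃ N : ℝ, 0 < N ∧
      ∀ T : EReal, ⊥ < T → ∀ c r : ℝ, 1 ≤ c → 0 < r →
      ∀ z0 : Pt d, (z0.1 : EReal) ≤ T →
        (∀ f : Pt d → ℝ, Measurable f →
          (∀ t : ℝ, (t : EReal) < T → Continuous (fun p : Ed d × Ed d => f (t, p.1, p.2))) →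
          lixvSemi α (slabI T) Set.univ f < ⊤ →
          ∑' k : ℕ, ENNReal.ofReal ((2:ℝ) ^ (-(k:ℝ)) *
              msq (kCyl r ((2:ℝ) ^ k * c * r) z0)
                (fun z => f z - f (z.1, z0.2.1 - (z.1 - z0.1) • z0.2.2, z0.2.2))) ≤
            ENNReal.ofReal (N * (c * r) ^ α) * lixvSemi α (slabI T) Set.univ f) ∧
        (∀ h : Pt d → ℝ, kSemi α (slabG d T) h < ⊤ →
          ∑' k : ℕ, ENNReal.ofReal ((2:ℝ) ^ (-(k:ℝ)) *
              oscL2 (kCyl r ((2:ℝ) ^ k * c * r) z0) h) ≤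
            ENNReal.ofReal (N * (c * r) ^ α) * kSemi α (slabG d T) h) := by
  have hq1 : (2 : ℝ) ^ (α - 1) < 1 :=
    Real.rpow_lt_one_of_one_lt_of_neg one_lt_two (by linarith [hα.2])
  refine ⟨2 ^ α * (1 - 2 ^ (α - 1))⁻¹,
    mul_pos (by positivity) (inv_pos.2 (by linarith)), fun T _ c r hc hr z0 hT => ?_⟩
  have hcr : r ≤ c * r := by nlinarith
  have hrad : ∀ k : ℕ, r ≤ (2 : ℝ) ^ k * c * r := fun k => by
    have : (1 : ℝ) ≤ 2 ^ k := one_le_pow₀ one_le_two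
    nlinarith
  refine ⟨fun f _ _ hf => ?_, fun h hh => ?_⟩
  · refine tsum_ofReal_le_of_le_rpow hα (hr.le.trans hcr) hf fun k => ?_
    rw [← mul_assoc ((2 : ℝ) ^ k)]
    have hs := hrad k
    generalize (2 : ℝ) ^ k * c * r = s at hs
    have hs0 : 0 ≤ s := hr.le.trans hs
    refine msq_le_of_norm_le (by positivity) (volume_kCyl_lt_top r s z0) fun z hz => ?_
    refine (norm_sub_le_lixvSemi hf (kCyl_subset_slabG hT hz).1 (p := z.2)
      (q := (z0.2.1 - (z.1 - z0.1) • z0.2.2, z0.2.2)) (mem_univ _) (mem_univ _)).trans ?_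
    obtain ⟨-, -, hv, hx⟩ := hz
    have hx' : ‖z.2.1 - (z0.2.1 - (z.1 - z0.1) • z0.2.2)‖ ^ ((1 : ℝ) / 3) ≤ s := by
      refine rpow_one_third_le (norm_nonneg _) hs0 ?_
      rw [← sub_add]
      exact hx.le
    refine mul_le_mul_of_nonneg_left ?_ ENNReal.toReal_nonneg
    exact Real.rpow_le_rpow (by positivity) (by dsimp only; linarith) hα.1.le
  · refine tsum_ofReal_le_of_le_rpow hα (hr.le.trans hcr) hh fun k => ?_
    rw [← mul_assoc ((2 : ℝ) ^ k)]
    have hs := hrad k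
    generalize (2 : ℝ) ^ k * c * r = s at hs
    have hs0 : 0 ≤ s := hr.le.trans hs
    have hsub : kCyl r s z0 ⊆ slabG d T := kCyl_subset_slabG hT
    refine oscL2_le_of_norm_sub_le (by positivity) (isOpen_kCyl r s z0)
      (volume_kCyl_lt_top r s z0) ((continuousOn_of_kSemi_lt_top hα.1 hh).mono hsub)
      fun z hz z' hz' => ?_
    refine (norm_sub_le_kSemi hh (hsub hz') (hsub hz)).trans ?_
    refine mul_le_mul_of_nonneg_left ?_ ENNReal.toReal_nonneg
    exact Real.rpow_le_rpow (kRho_nonneg _ _) (kRho_le_of_mem_kCyl hr hs hz' hz) hα.1.le
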